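/- arXiv:1508.02519 — 3 statements merged into one kernel-verified Lean document; each statement's English description precedes it below -/
import Mathlib

section
/- Let U ⊆ ℝ^d be open, let n : U → ℝ^d be differentiable at a point x ∈ U with ‖n(x)‖ = 1, and define the matrix field P(y) := I − n(y) n(y)ᵀ for y ∈ U and the mean curvature κ(x) := Tr(P(x) · Dn(x)), where Dn(x) is the Jacobian matrix of n at x. Then P is differentiable at x and ((P∇)ᵀ P)(x) = −κ(x) n(x), i.e. for every k ∈ {1,…,d} one has Σ_{j=1}^d Σ_{l=1}^d P(x)_{jl} ∂_l P_{jk}(x) = −κ(x) n_k(x). -/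
open scoped Matrix

/-- The partial derivatives of the entries of `I - n nᵀ`, by the product rule. -/
theorem hasFDerivAt_one_sub_mul_entry {d : ℕ} {n : (Fin d → ℝ) → (Fin d → ℝ)} {x : Fin d → ℝ}
    (hdiff : DifferentiableAt ℝ n x) (j k : Fin d) :
    HasFDerivAt
      (fun y => ((1 : Matrix (Fin d) (Fin d) ℝ) - Matrix.of (fun j k => n y j * n y k)) j k)
      (-(n x j • (ContinuousLinearMap.proj k).comp (fderiv ℝ n x) +
        n x k • (ContinuousLinearMap.proj j).comp (fderiv ℝ n x))) x := by
  have h := hasFDerivAt_pi'.1 hdiff.hasFDerivAt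
  exact
    ((h j).mul (h k)).const_sub ((1 : Matrix (Fin d) (Fin d) ℝ) j k)

/-- The matrix `I - v vᵀ` annihilates the unit vector `v`. -/
theorem sum_one_sub_mul_mul_eq_zero {d : ℕ} {v : Fin d → ℝ} (hv : ∑ j, v j ^ 2 = 1) (l : Fin d) :
    ∑ j, ((1 : Matrix (Fin d) (Fin d) ℝ) j l - v j * v l) * v j = 0 := by
  have h : ∑ j, v j * v l * v j = v l := by
    calc ∑ j, v j * v l * v j = (∑ j, v j ^ 2) * v l := by
          rw [Finset.sum_mul]
          exact Finset.sum_congr rfl fun j _ => by ring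
      _ = v l := by rw [hv, one_mul]
  simp only [sub_mul, Finset.sum_sub_distrib, h]
  simp [Matrix.one_apply]

/-- Lemma 2.6 of the paper.
Let `U ⊆ ℝ^d` be open, `n : U → ℝ^d` differentiable at `x ∈ U` with `‖n x‖ = 1`
(euclidean norm), `P y := I - n(y) n(y)ᵀ`, and
`κ := Tr (P x * Dn x)` with `Dn x` the Jacobian of `n` at `x`.
Then `P` is differentiable at `x` and `((P∇)ᵀ P)(x) = -κ • n(x)`, i.e. for every `k`,
`∑_j ∑_l P(x)_{jl} ∂_l P_{jk}(x) = -κ * n(x)_k`. -/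
theorem sticky_mean_curvature_identity {d : ℕ}
    (U : Set (Fin d → ℝ)) (hU : IsOpen U)
    (n : (Fin d → ℝ) → (Fin d → ℝ)) (x : Fin d → ℝ) (hx : x ∈ U)
    (hdiff : DifferentiableAt ℝ n x)
    (hnorm : ∑ j, (n x j) ^ 2 = 1)
    (P : (Fin d → ℝ) → Matrix (Fin d) (Fin d) ℝ)
    (hP : ∀ y, P y = 1 - Matrix.of (fun j k => n y j * n y k))
    (κ : ℝ)
    (hκ : κ = Matrix.trace (P x * Matrix.of (fun j l => fderiv ℝ n x (Pi.single l 1) j))) :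
    (∀ j k, DifferentiableAt ℝ (fun y => P y j k) x) ∧
      ∀ k, ∑ j, ∑ l, P x j l * fderiv ℝ (fun y => P y j k) x (Pi.single l 1)
        = -κ * n x k := by
  obtain rfl : P = fun y => 1 - Matrix.of (fun j k => n y j * n y k) := funext hP
  have hD := hasFDerivAt_one_sub_mul_entry hdiff
  refine ⟨fun j k => (hD j k).differentiableAt, fun k => ?_⟩
  have hκ' : κ = ∑ j, ∑ l, ((1 : Matrix (Fin d) (Fin d) ℝ) j l - n x j * n x l) *
      fderiv ℝ n x (Pi.single l 1) j := by
    rw [hκ, Matrix.trace, Finset.sum_comm]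
    simp only [Matrix.diag_apply, Matrix.mul_apply, Matrix.sub_apply, Matrix.of_apply]
    refine Finset.sum_congr rfl fun l _ => Finset.sum_congr rfl fun j _ => ?_
    simp only [Matrix.one_apply, eq_comm (a := l), mul_comm (n x l)]
  have hnormal : ∑ j, ∑ l, ((1 : Matrix (Fin d) (Fin d) ℝ) j l - n x j * n x l) * n x j *
      fderiv ℝ n x (Pi.single l 1) k = 0 := by
    rw [Finset.sum_comm]
    simp [← Finset.sum_mul, sum_one_sub_mul_mul_eq_zero hnorm]
  rw [← sub_zero (-κ * n x k), ← hnormal, hκ', neg_mul, Finset.sum_mul,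
    ← Finset.sum_neg_distrib, ← Finset.sum_sub_distrib]
  refine Finset.sum_congr rfl fun j _ => ?_
  rw [Finset.sum_mul, ← Finset.sum_neg_distrib, ← Finset.sum_sub_distrib]
  refine Finset.sum_congr rfl fun l _ => ?_
  rw [(hD j k).fderiv]
  simp
  ring
end

section
/- Let Ω ⊆ ℝ^d be a nonempty bounded open set whose boundary Γ := ∂Ω has Lebesgue measure zero, let λ be the Lebesgue measure on ℝ^d restricted to Ω, let σ be a finite Borel measure on ℝ^d concentrated on Γ, let N ∈ ℕ, Λ := (closure Ω)^N, and let m be the N-fold product measure of (λ + σ) on (ℝ^d)^N. Let ϱ : (ℝ^d)^N → [0,∞) be Borel measurable with ∫_Λ ϱ dm < ∞ and ϱ > 0 m-a.e. on Λ, and set μ := ϱ · m restricted to Λ. For C¹ functions f, g : (ℝ^d)^N → ℝ define E(f,g) := ½ ∫_Λ Σ_{i=1}^N 1_Ω(x^i) ⟨∇_i f(x), ∇_i g(x)⟩ dμ(x), where ∇_i is the gradient in the i-th block of d coordinates. Assume the Hamza condition (H1): for every nonempty B ⊆ {1,…,N} and for ∏_{i ∉ B} σ-a.e. choice of boundary coordinates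 x ∈ Γ^{N−|B|}, the slice function y ↦ ϱ(z_{(B,x,y)}) (obtained by filling the coordinates indexed by B with y ∈ Ω^{|B|} and the remaining coordinates with x) vanishes ∏_{i ∈ B} λ-a.e. on the complement in Ω^{|B|} of the set R(B,x) := { y ∈ Ω^{|B|} : ∫_{{z : |z−y| < ε}} ϱ(z_{(B,x,·)})^{-1} d(∏_{i∈B} λ) < ∞ for some ε > 0 }. Then the form E is closable on L²(μ) in the following sense: for every sequence (f_k) of C¹ functions on (ℝ^d)^N such that E(f_k − f_l, f_k − f_l) → 0 as k, l → ∞ and ∫_Λ f_k² dμ → 0 as k → ∞, one has E(f_k, f_k) → 0 as k → ∞. -/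
open MeasureTheory
open scoped ENNReal

/-- `⟨∇_i f(x), ∇_i g(x)⟩`: the inner product of the gradients of `f` and `g`
in the `i`-th block of `d` coordinates, at the configuration `x`. -/
noncomputable def gradBlockInner (d N : ℕ) (f g : (Fin N → Fin d → ℝ) → ℝ)
    (x : Fin N → Fin d → ℝ) (i : Fin N) : ℝ :=
  ∑ k : Fin d, fderiv ℝ f x (Pi.single i (Pi.single k 1)) *
    fderiv ℝ g x (Pi.single i (Pi.single k 1))

/-- The pre-Dirichlet form `E(f,g) = ½ ∫_Λ ∑_i 1_Ω(xⁱ) ⟨∇_i f, ∇_i g⟩ dμ`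
(case `δ = 0`). -/
noncomputable def stickyForm (d N : ℕ) (Ω : Set (Fin d → ℝ))
    (Λ : Set (Fin N → Fin d → ℝ)) (μ : Measure (Fin N → Fin d → ℝ))
    (f g : (Fin N → Fin d → ℝ) → ℝ) : ℝ :=
  (1 / 2) * ∫ x in Λ,
    ∑ i, Set.indicator Ω (fun _ => (1 : ℝ)) (x i) * gradBlockInner d N f g x i ∂μ

/-- The configuration `z_{(B,x,y)}`: the coordinates indexed by `B` are filled with
`y`, the remaining ones with `x`. -/
def fillConfig (d N : ℕ) (B : Finset (Fin N))
    (x : {i : Fin N // i ∉ B} → Fin d → ℝ) (y : {i : Fin N // i ∈ B} → Fin d → ℝ) :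
    Fin N → Fin d → ℝ :=
  fun i => if h : i ∈ B then y ⟨i, h⟩ else x ⟨i, h⟩

open Filter Topology

/-- Weighted Cauchy–Schwarz inequality. -/
theorem lintegral_le_sqrt_lintegral_sq_mul_weight {α : Type*} [MeasurableSpace α]
    {ν : Measure α} {u w : α → ℝ≥0∞} (hu : AEMeasurable u ν) (hw : AEMeasurable w ν)
    (hw0 : ∀ᵐ x ∂ν, w x ≠ 0) (hwt : ∀ᵐ x ∂ν, w x ≠ ⊤) :
    ∫⁻ x, u x ∂ν ≤
      (∫⁻ x, u x ^ 2 * w x ∂ν) ^ (1 / 2 : ℝ) * (∫⁻ x, (w x)⁻¹ ∂ν) ^ (1 / 2 : ℝ) := by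
  have key := ENNReal.lintegral_mul_le_Lp_mul_Lq ν Real.HolderConjugate.two_two
    (f := fun x => u x * w x ^ (1 / 2 : ℝ)) (g := fun x => ((w x)⁻¹) ^ (1 / 2 : ℝ))
    (hu.mul (hw.pow_const _)) (hw.inv.pow_const _)
  have half : ∀ a : ℝ≥0∞, (a ^ (1 / 2 : ℝ)) ^ (2 : ℝ) = a := fun a => by
    rw [← ENNReal.rpow_mul]; norm_num
  simp only [half, ENNReal.mul_rpow_of_nonneg _ _ (zero_le_two : (0 : ℝ) ≤ 2)] at key
  simp only [ENNReal.rpow_two] at key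
  refine le_trans (le_of_eq (lintegral_congr_ae ?_)) key
  filter_upwards [hw0, hwt] with x h0 ht
  simp only [Pi.mul_apply]
  rw [mul_assoc, ← ENNReal.mul_rpow_of_nonneg _ _ (by norm_num : (0 : ℝ) ≤ 1 / 2),
    ENNReal.mul_inv_cancel h0 ht, ENNReal.one_rpow, mul_one]

theorem tendsto_lintegral_enorm_of_weighted {α F : Type*} [MeasurableSpace α]
    [NormedAddCommGroup F] {ν : Measure α} {u : ℕ → α → F} {w : α → ℝ≥0∞}
    (hu : ∀ n, AEStronglyMeasurable (u n) ν) (hw : AEMeasurable w ν)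
    (hwt : ∀ x, w x ≠ ⊤) (hinv : ∫⁻ x, (w x)⁻¹ ∂ν < ⊤)
    (hlim : Tendsto (fun n => ∫⁻ x, ‖u n x‖ₑ ^ 2 * w x ∂ν) atTop (𝓝 0)) :
    Tendsto (fun n => ∫⁻ x, ‖u n x‖ₑ ∂ν) atTop (𝓝 0) := by
  have hw0 : ∀ᵐ x ∂ν, w x ≠ 0 := by
    filter_upwards [ae_lt_top' hw.inv hinv.ne] with x hx h0
    simp [h0] at hx
  have hK : (∫⁻ x, (w x)⁻¹ ∂ν) ^ (1 / 2 : ℝ) ≠ ⊤ :=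
    ENNReal.rpow_ne_top_of_nonneg (by norm_num) hinv.ne
  refine tendsto_of_tendsto_of_tendsto_of_le_of_le tendsto_const_nhds ?_
    (fun _ => zero_le) (fun n => lintegral_le_sqrt_lintegral_sq_mul_weight
      (hu n).enorm hw hw0 (.of_forall hwt))
  have h1 := ((ENNReal.continuous_rpow_const (y := 1 / 2)).tendsto 0).comp hlim
  rw [ENNReal.zero_rpow_of_pos (by norm_num)] at h1
  simpa using ENNReal.Tendsto.mul_const h1 (Or.inr hK)

section Slice

variable {E : Type*} [NormedAddCommGroup E] [NormedSpace ℝ E] [FiniteDimensional ℝ E]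
  [MeasurableSpace E] [BorelSpace E] {ν : Measure E} [ν.IsAddHaarMeasure]

/-- If `gₙ → 0` and `∂ᵥ gₙ → h` in `L¹(b)`, then `h = 0` on the bounded open set `b`. -/
theorem ae_eq_zero_of_tendsto_lintegral_fderiv {b : Set E} (hb : IsOpen b)
    (hbb : Bornology.IsBounded b) {g : ℕ → E → ℝ} (hg : ∀ n, ContDiff ℝ 1 (g n)) (v : E)
    {h : E → ℝ} (hh : AEStronglyMeasurable h (ν.restrict b))
    (hg0 : Tendsto (fun n => ∫⁻ x in b, ‖g n x‖ₑ ∂ν) atTop (𝓝 0))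
    (hgh : Tendsto (fun n => ∫⁻ x in b, ‖fderiv ℝ (g n) x v - h x‖ₑ ∂ν) atTop (𝓝 0)) :
    ∀ᵐ x ∂ν.restrict b, h x = 0 := by
  have hcont : ∀ n, Continuous fun x => fderiv ℝ (g n) x v := fun n =>
    ((hg n).continuous_fderiv one_ne_zero).clm_apply continuous_const
  have h_int : ∀ f : E → ℝ, Continuous f → IntegrableOn f b ν := fun f hf =>
    (hf.continuousOn.integrableOn_compact hbb.isCompact_closure).mono_set subset_closure
  have hdiff : ∀ᶠ n in atTop, IntegrableOn (fun x => fderiv ℝ (g n) x v - h x) b ν := by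
    filter_upwards [hgh.eventually_lt_const ENNReal.zero_lt_top] with n hn
    exact ⟨(hcont n).aestronglyMeasurable.sub hh, hn⟩
  have hhint : IntegrableOn h b ν := by
    obtain ⟨n, hn⟩ := hdiff.exists
    exact ((h_int _ (hcont n)).sub hn).congr (.of_forall fun x => by simp)
  rw [ae_restrict_iff' hb.measurableSet]
  refine hb.ae_eq_zero_of_integral_contDiff_smul_eq_zero hhint.locallyIntegrableOn ?_
  intro φ hφ hφc hφb
  have hφ1 : ContDiff ℝ 1 φ := hφ.of_le (by exact_mod_cast le_top)
  have hφ'c : Continuous fun x => fderiv ℝ φ x v :=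
    (hφ1.continuous_fderiv one_ne_zero).clm_apply continuous_const
  have hφ's : HasCompactSupport fun x => fderiv ℝ φ x v := hφc.fderiv_apply (𝕜 := ℝ) v
  obtain ⟨C, hC⟩ := hφc.exists_bound_of_continuous hφ1.continuous
  obtain ⟨C', hC'⟩ := hφ's.exists_bound_of_continuous hφ'c
  have hφ0 : ∀ x, x ∉ b → φ x = 0 := fun x hx => image_eq_zero_of_notMem_tsupport
    fun hx' => hx (hφb hx')
  have hφ'0 : ∀ x, x ∉ b → fderiv ℝ φ x v = 0 := fun x hx => by
    rw [image_eq_zero_of_notMem_tsupport (f := fderiv ℝ φ)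
      fun hx' => hx (hφb (tsupport_fderiv_subset ℝ hx'))]
    simp
  have hle : ∀ (ψ : E → ℝ) (D : ℝ), (∀ x, ‖ψ x‖ ≤ D) → ∀ u : E → ℝ,
      ‖∫ x in b, ψ x * u x ∂ν‖ₑ ≤ ENNReal.ofReal D * ∫⁻ x in b, ‖u x‖ₑ ∂ν := by
    intro ψ D hD u
    refine (enorm_integral_le_lintegral_enorm _).trans ?_
    rw [← lintegral_const_mul' _ _ ENNReal.ofReal_ne_top]
    refine lintegral_mono fun x => ?_
    rw [enorm_mul]
    gcongr
    rw [← ofReal_norm]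
    exact ENNReal.ofReal_le_ofReal (hD x)
  have hparts : ∀ n, ∫ x in b, φ x * fderiv ℝ (g n) x v ∂ν
      = -∫ x in b, fderiv ℝ φ x v * g n x ∂ν := by
    intro n
    rw [setIntegral_eq_integral_of_forall_compl_eq_zero fun x hx => by simp [hφ0 x hx],
      setIntegral_eq_integral_of_forall_compl_eq_zero fun x hx => by simp [hφ'0 x hx]]
    refine integral_mul_fderiv_eq_neg_fderiv_mul_of_integrable ?_ ?_ ?_
      (fun x _ => hφ1.differentiable one_ne_zero x)
      (fun x _ => (hg n).differentiable one_ne_zero x)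
    · exact (hφ'c.mul (hg n).continuous).integrable_of_hasCompactSupport hφ's.mul_right
    · exact (hφ1.continuous.mul (hcont n)).integrable_of_hasCompactSupport hφc.mul_right
    · exact (hφ1.continuous.mul (hg n).continuous).integrable_of_hasCompactSupport hφc.mul_right
  have hbound : ∀ᶠ n in atTop, ‖∫ x in b, φ x * h x ∂ν‖ₑ ≤
      ENNReal.ofReal C' * ∫⁻ x in b, ‖g n x‖ₑ ∂ν +
        ENNReal.ofReal C * ∫⁻ x in b, ‖fderiv ℝ (g n) x v - h x‖ₑ ∂ν := by
    filter_upwards [hdiff] with n hn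
    have hmul : IntegrableOn (fun x => φ x * (fderiv ℝ (g n) x v - h x)) b ν :=
      Integrable.bdd_mul hn hφ1.continuous.aestronglyMeasurable (.of_forall hC)
    have heq : ∫ x in b, φ x * h x ∂ν = ∫ x in b, φ x * fderiv ℝ (g n) x v ∂ν
        - ∫ x in b, φ x * (fderiv ℝ (g n) x v - h x) ∂ν := by
      rw [← integral_sub (f := fun x => φ x * fderiv ℝ (g n) x v)
        (h_int _ (hφ1.continuous.mul (hcont n))) hmul]
      exact integral_congr_ae (.of_forall fun x => by ring)
    rw [heq, hparts]
    refine enorm_sub_le.trans ?_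
    rw [enorm_neg]
    exact add_le_add (hle _ _ hC' _) (hle _ _ hC _)
  have hlim := (ENNReal.Tendsto.const_mul (a := ENNReal.ofReal C') hg0
    (Or.inr ENNReal.ofReal_ne_top)).add (ENNReal.Tendsto.const_mul (a := ENNReal.ofReal C) hgh
    (Or.inr ENNReal.ofReal_ne_top))
  simp only [mul_zero, add_zero] at hlim
  have h0 : ‖∫ x in b, φ x * h x ∂ν‖ₑ = 0 :=
    le_antisymm (ge_of_tendsto hlim hbound) (zero_le)
  rw [setIntegral_eq_integral_of_forall_compl_eq_zero fun x hx => by simp [hφ0 x hx]] at h0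
  simpa using h0

/-- Closability of the directional derivative on a slice, under a local Hamza condition. -/
theorem ae_weight_eq_zero_or_eq_zero {U : Set E} (hU : IsOpen U)
    {w : E → ℝ≥0∞} (hw : Measurable w) (hwt : ∀ x, w x ≠ ⊤)
    (hH : ∀ᵐ y ∂ν.restrict U, y ∉ {y' | ∃ ε > 0,
      ∫⁻ z in Metric.ball y' ε, (w z)⁻¹ ∂ν.restrict U < ⊤} → w y = 0)
    {g : ℕ → E → ℝ} (hg : ∀ n, ContDiff ℝ 1 (g n)) (v : E) {h : E → ℝ} (hh : Measurable h)
    (hg0 : Tendsto (fun n => ∫⁻ x in U, ‖g n x‖ₑ ^ 2 * w x ∂ν) atTop (𝓝 0))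
    (hgh : Tendsto (fun n => ∫⁻ x in U, ‖fderiv ℝ (g n) x v - h x‖ₑ ^ 2 * w x ∂ν)
      atTop (𝓝 0)) :
    ∀ᵐ y ∂ν.restrict U, w y = 0 ∨ h y = 0 := by
  set R := {y' | ∃ ε > 0, ∫⁻ z in Metric.ball y' ε, (w z)⁻¹ ∂ν.restrict U < ⊤} with hR
  have hnull : ν ({y | h y ≠ 0} ∩ (U ∩ R)) = 0 := by
    refine measure_null_of_locally_null _ fun y hy => ?_
    obtain ⟨-, hyU, ε, hε, hfin⟩ := hy
    obtain ⟨δ, hδ, hδU⟩ := Metric.isOpen_iff.1 hU y hyU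
    set b := Metric.ball y (min ε δ) with hb
    have hbU : b ⊆ U := (Metric.ball_subset_ball (min_le_right _ _)).trans hδU
    have hbε : b ⊆ Metric.ball y ε := Metric.ball_subset_ball (min_le_left _ _)
    have hfin' : ∫⁻ z in b, (w z)⁻¹ ∂ν < ⊤ := by
      refine lt_of_le_of_lt (lintegral_mono' ?_ le_rfl) hfin
      rw [Measure.restrict_restrict Metric.isOpen_ball.measurableSet]
      exact Measure.restrict_mono (Set.subset_inter hbε hbU) le_rfl
    have hsmall : ∀ F : ℕ → E → ℝ≥0∞, Tendsto (fun n => ∫⁻ x in U, F n x ∂ν) atTop (𝓝 0) →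
        Tendsto (fun n => ∫⁻ x in b, F n x ∂ν) atTop (𝓝 0) := fun F hF =>
      tendsto_of_tendsto_of_tendsto_of_le_of_le tendsto_const_nhds hF
        (fun _ => zero_le) (fun n => lintegral_mono_set hbU)
    have hcont : ∀ n, Continuous fun x => fderiv ℝ (g n) x v := fun n =>
      ((hg n).continuous_fderiv one_ne_zero).clm_apply continuous_const
    have hzero := ae_eq_zero_of_tendsto_lintegral_fderiv (ν := ν) (b := b) Metric.isOpen_ball
      Metric.isBounded_ball hg v hh.aestronglyMeasurable
      (tendsto_lintegral_enorm_of_weighted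
        (fun n => (hg n).continuous.aestronglyMeasurable) hw.aemeasurable hwt hfin'
        (hsmall _ hg0))
      (tendsto_lintegral_enorm_of_weighted
        (fun n => ((hcont n).measurable.sub hh).aestronglyMeasurable) hw.aemeasurable hwt hfin'
        (hsmall _ hgh))
    refine ⟨{y | h y ≠ 0} ∩ b ∩ ({y | h y ≠ 0} ∩ (U ∩ R)), ?_, ?_⟩
    · have hbn : b ∈ 𝓝 y := Metric.ball_mem_nhds y (lt_min hε hδ)
      filter_upwards [self_mem_nhdsWithin, mem_nhdsWithin_of_mem_nhds hbn] with z hz hzb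
      exact ⟨⟨hz.1, hzb⟩, hz⟩
    · refine measure_mono_null Set.inter_subset_left ?_
      have hne : MeasurableSet {y | h y ≠ 0} :=
        (measurableSet_eq_fun hh measurable_const).compl
      rwa [← Measure.restrict_apply hne]
  rw [ae_restrict_iff' hU.measurableSet] at hH ⊢
  filter_upwards [hH, measure_eq_zero_iff_ae_notMem.1 hnull] with y hy hy' hyU
  by_cases hyR : y ∈ R
  · exact Or.inr (by_contra fun hne => hy' ⟨hne, hyU, hyR⟩)
  · exact Or.inl (hy hyU hyR)

end Slice

theorem exists_seq_tendsto_ae_of_tendsto_lintegral {α : Type*} [MeasurableSpace α]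
    {μ : Measure α} {F : ℕ → α → ℝ≥0∞} (hF : ∀ n, AEMeasurable (F n) μ)
    (hlim : Tendsto (fun n => ∫⁻ x, F n x ∂μ) atTop (𝓝 0)) :
    ∃ ns : ℕ → ℕ, StrictMono ns ∧
      ∀ᵐ x ∂μ, Tendsto (fun j => F (ns j) x) atTop (𝓝 0) := by
  obtain ⟨ns, hns, hle⟩ := extraction_forall_of_eventually' (P := fun j n =>
    ∫⁻ x, F n x ∂μ ≤ (2⁻¹ : ℝ≥0∞) ^ j) fun j =>
      eventually_atTop.1 (hlim.eventually_le_const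
        (ENNReal.pow_pos (ENNReal.inv_pos.2 ENNReal.ofNat_ne_top) j))
  refine ⟨ns, hns, ?_⟩
  have hfin : ∫⁻ x, ∑' j, F (ns j) x ∂μ ≠ ⊤ := by
    rw [lintegral_tsum fun j => hF (ns j)]
    refine ne_top_of_le_ne_top ?_ (ENNReal.tsum_le_tsum hle)
    rw [ENNReal.tsum_geometric, ENNReal.one_sub_inv_two]
    simp
  filter_upwards [ae_lt_top' (AEMeasurable.tsum fun j => hF (ns j)) hfin] with x hx
  exact ENNReal.tendsto_atTop_zero_of_tsum_ne_top hx.ne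

section FillConfig

variable {d N : ℕ}

/-- The linear part of `fillConfig`: extension by zero outside `B`. -/
noncomputable def fillLinear (d N : ℕ) (B : Finset (Fin N)) :
    ({i : Fin N // i ∈ B} → Fin d → ℝ) →L[ℝ] (Fin N → Fin d → ℝ) :=
  ContinuousLinearMap.pi fun i =>
    if h : i ∈ B then ContinuousLinearMap.proj ⟨i, h⟩ else 0

theorem fillConfig_eq_add (B : Finset (Fin N)) (x : {i : Fin N // i ∉ B} → Fin d → ℝ)
    (y : {i : Fin N // i ∈ B} → Fin d → ℝ) :
    fillConfig d N B x y = fillConfig d N B x 0 + fillLinear d N B y := by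
  ext i : 1
  by_cases h : i ∈ B <;> simp [fillConfig, fillLinear, h]

theorem fillLinear_single (B : Finset (Fin N)) {i : Fin N} (hi : i ∈ B) (e : Fin d → ℝ) :
    fillLinear d N B (Pi.single ⟨i, hi⟩ e) = Pi.single i e := by
  ext j : 1
  by_cases hj : j ∈ B
  · by_cases hij : j = i
    · subst hij; simp [fillLinear, hj]
    · simp [fillLinear, hj, hij]
  · have hij : j ≠ i := fun h => hj (h ▸ hi)
    simp [fillLinear, hj, hij]

theorem hasFDerivAt_fillConfig (B : Finset (Fin N)) (x : {i : Fin N // i ∉ B} → Fin d → ℝ)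
    (y : {i : Fin N // i ∈ B} → Fin d → ℝ) :
    HasFDerivAt (fillConfig d N B x) (fillLinear d N B) y := by
  rw [funext (fillConfig_eq_add B x)]
  exact (fillLinear d N B).hasFDerivAt.const_add _

theorem contDiff_fillConfig (B : Finset (Fin N)) (x : {i : Fin N // i ∉ B} → Fin d → ℝ) :
    ContDiff ℝ 1 (fillConfig d N B x) := by
  rw [funext (fillConfig_eq_add B x)]
  exact contDiff_const.add (fillLinear d N B).contDiff

theorem fderiv_comp_fillConfig (B : Finset (Fin N)) (x : {i : Fin N // i ∉ B} → Fin d → ℝ)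
    (y : {i : Fin N // i ∈ B} → Fin d → ℝ) {f : (Fin N → Fin d → ℝ) → ℝ}
    (hf : ContDiff ℝ 1 f) {i : Fin N} (hi : i ∈ B) (e : Fin d → ℝ) :
    fderiv ℝ (fun y => f (fillConfig d N B x y)) y (Pi.single ⟨i, hi⟩ e) =
      fderiv ℝ f (fillConfig d N B x y) (Pi.single i e) := by
  have h := ((hf.differentiable one_ne_zero _).hasFDerivAt).comp y
    (hasFDerivAt_fillConfig B x y)
  rw [show (fun y => f (fillConfig d N B x y)) = f ∘ fillConfig d N B x from rfl, h.fderiv]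
  simp [fillLinear_single B hi]

theorem measurePreserving_fillConfig (B : Finset (Fin N)) (κ σ : Measure (Fin d → ℝ))
    [SigmaFinite κ] [SigmaFinite σ] :
    MeasurePreserving (fun p : ({i : Fin N // i ∉ B} → Fin d → ℝ) ×
        ({i : Fin N // i ∈ B} → Fin d → ℝ) => fillConfig d N B p.1 p.2)
      ((Measure.pi fun _ : {i : Fin N // i ∉ B} => σ).prod
        (Measure.pi fun _ : {i : Fin N // i ∈ B} => κ))
      (Measure.pi fun i => if i ∈ B then κ else σ) := by
  have hsf : ∀ i, SigmaFinite (if i ∈ B then κ else σ) := fun i => by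
    split_ifs <;> infer_instance
  have h := (measurePreserving_piEquivPiSubtypeProd
    (fun i : Fin N => if i ∈ B then κ else σ) (· ∈ B)).symm
  have h1 : (fun i : {i : Fin N // i ∈ B} => if (i : Fin N) ∈ B then κ else σ) = fun _ => κ :=
    funext fun i => if_pos i.2
  have h2 : (fun i : {i : Fin N // i ∉ B} => if (i : Fin N) ∈ B then κ else σ) = fun _ => σ :=
    funext fun i => if_neg i.2
  have h' : MeasurePreserving (MeasurableEquiv.piEquivPiSubtypeProd
      (fun _ : Fin N => Fin d → ℝ) (· ∈ B)).symm
      ((Measure.pi fun _ : {i : Fin N // i ∈ B} => κ).prod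
        (Measure.pi fun _ : {i : Fin N // i ∉ B} => σ))
      (Measure.pi fun i => if i ∈ B then κ else σ) := by
    convert h using 3
    · exact h1.symm
    · exact h2.symm
  exact h'.comp Measure.measurePreserving_swap

end FillConfig

/-- Closability on the stratum where exactly the particles in `B` are in the interior. -/
theorem ae_weight_eq_zero_or_eq_zero_on_stratum {d N : ℕ} {Ω : Set (Fin d → ℝ)}
    (hΩo : IsOpen Ω) (σ : Measure (Fin d → ℝ)) [SigmaFinite σ] (B : Finset (Fin N))
    {w : (Fin N → Fin d → ℝ) → ℝ≥0∞} (hw : Measurable w) (hwt : ∀ x, w x ≠ ⊤)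
    (hH : ∀ᵐ x ∂(Measure.pi fun _ : {i : Fin N // i ∉ B} => σ),
      ∀ᵐ y ∂(Measure.pi fun _ : {i : Fin N // i ∈ B} => volume.restrict Ω),
        y ∉ {y' : {i : Fin N // i ∈ B} → Fin d → ℝ | ∃ ε > 0,
          (∫⁻ z in Metric.ball y' ε, (w (fillConfig d N B x z))⁻¹
            ∂(Measure.pi fun _ : {i : Fin N // i ∈ B} => volume.restrict Ω)) < ⊤} →
        w (fillConfig d N B x y) = 0)
    {f : ℕ → (Fin N → Fin d → ℝ) → ℝ} (hf : ∀ n, ContDiff ℝ 1 (f n)) {i : Fin N} (hi : i ∈ B)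
    (e : Fin d → ℝ) {h : (Fin N → Fin d → ℝ) → ℝ} (hh : Measurable h)
    (hf0 : Tendsto (fun n => ∫⁻ z, ‖f n z‖ₑ ^ 2 * w z
      ∂(Measure.pi fun i => if i ∈ B then volume.restrict Ω else σ)) atTop (𝓝 0))
    (hfh : Tendsto (fun n => ∫⁻ z, ‖fderiv ℝ (f n) z (Pi.single i e) - h z‖ₑ ^ 2 * w z
      ∂(Measure.pi fun i => if i ∈ B then volume.restrict Ω else σ)) atTop (𝓝 0)) :
    ∀ᵐ z ∂(Measure.pi fun i => if i ∈ B then volume.restrict Ω else σ), w z = 0 ∨ h z = 0 := by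
  have hmp := measurePreserving_fillConfig B (volume.restrict Ω) σ
  have hcont : ∀ n, Continuous fun z => fderiv ℝ (f n) z (Pi.single i e) := fun n =>
    ((hf n).continuous_fderiv one_ne_zero).clm_apply continuous_const
  have hG1 : ∀ n, Measurable fun z => ‖f n z‖ₑ ^ 2 * w z := fun n =>
    ((hf n).continuous.measurable.enorm.pow_const 2).mul hw
  have hG2 : ∀ n, Measurable fun z =>
      ‖fderiv ℝ (f n) z (Pi.single i e) - h z‖ₑ ^ 2 * w z := fun n =>
    ((((hcont n).measurable.sub hh).enorm).pow_const 2).mul hw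
  have hsum := hf0.add hfh
  simp only [add_zero] at hsum
  simp_rw [← lintegral_add_left (hG1 _)] at hsum
  have hG : ∀ n, Measurable fun z => ‖f n z‖ₑ ^ 2 * w z +
      ‖fderiv ℝ (f n) z (Pi.single i e) - h z‖ₑ ^ 2 * w z := fun n => (hG1 n).add (hG2 n)
  have hprod : ∀ F : (Fin N → Fin d → ℝ) → ℝ≥0∞, Measurable F →
      ∫⁻ z, F z ∂(Measure.pi fun i => if i ∈ B then volume.restrict Ω else σ) =
        ∫⁻ x, ∫⁻ y, F (fillConfig d N B x y)
          ∂(Measure.pi fun _ : {i : Fin N // i ∈ B} => volume.restrict Ω)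
          ∂(Measure.pi fun _ : {i : Fin N // i ∉ B} => σ) := fun F hF => by
    rw [← hmp.lintegral_comp hF]
    exact lintegral_prod _ (hF.comp hmp.measurable).aemeasurable
  replace hsum := hsum.congr fun n => hprod _ (hG n)
  obtain ⟨ns, -, hns⟩ := exists_seq_tendsto_ae_of_tendsto_lintegral
    (fun n => ((hG n).comp hmp.measurable).lintegral_prod_right'.aemeasurable) hsum
  have hset : MeasurableSet {z | w z = 0 ∨ h z = 0} :=
    (measurableSet_eq_fun hw measurable_const).union (measurableSet_eq_fun hh measurable_const)
  rw [← hmp.map_eq, ae_map_iff hmp.measurable.aemeasurable hset]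
  refine (Measure.ae_prod_iff_ae_ae (hmp.measurable hset)).2 ?_
  filter_upwards [hH, hns] with x hHx hx
  have hfill : Measurable (fillConfig d N B x) := (contDiff_fillConfig B x).continuous.measurable
  have : (volume : Measure ({i : Fin N // i ∈ B} → Fin d → ℝ)).IsAddHaarMeasure :=
    Measure.pi.isAddHaarMeasure _
  rw [← Measure.restrict_pi_pi, ← volume_pi] at hHx hx ⊢
  refine ae_weight_eq_zero_or_eq_zero (ν := volume)
    (isOpen_set_pi Set.finite_univ fun _ _ => hΩo) (hw.comp hfill) (fun _ => hwt _) hHx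
    (g := fun j y => f (ns j) (fillConfig d N B x y))
    (fun j => (hf _).comp (contDiff_fillConfig B x)) (Pi.single ⟨i, hi⟩ e) (hh.comp hfill) ?_ ?_
  · exact tendsto_of_tendsto_of_tendsto_of_le_of_le tendsto_const_nhds hx
      (fun _ => zero_le) (fun n => lintegral_mono fun y => le_self_add)
  · simp_rw [fderiv_comp_fillConfig B x _ (hf _) hi]
    exact tendsto_of_tendsto_of_tendsto_of_le_of_le tendsto_const_nhds hx
      (fun _ => zero_le) (fun n => lintegral_mono fun y => le_add_self)

theorem ae_pi_forall_mem {d : ℕ} {ι : Type*} [Fintype ι] {s : Set (Fin d → ℝ)}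
    {σ : Measure (Fin d → ℝ)} [SigmaFinite σ] (hσ : σ sᶜ = 0) :
    ∀ᵐ x ∂(Measure.pi fun _ : ι => σ), ∀ i, x i ∈ s :=
  eventually_all.2 fun i =>
    (Measure.tendsto_eval_ae_ae (μ := fun _ : ι => σ) (i := i)).eventually
      (show ∀ᵐ y ∂σ, y ∈ s from hσ)

section Stratification

variable {d N : ℕ} {Ω : Set (Fin d → ℝ)}

/-- Configurations with exactly the particles in `B` in `Ω` and the others on the boundary. -/
def stratum (Ω : Set (Fin d → ℝ)) (B : Finset (Fin N)) : Set (Fin N → Fin d → ℝ) :=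
  Set.univ.pi fun i => if i ∈ B then Ω else frontier Ω

theorem measurableSet_stratum (hΩo : IsOpen Ω) (B : Finset (Fin N)) :
    MeasurableSet (stratum Ω B) :=
  MeasurableSet.univ_pi fun i => by
    split_ifs
    exacts [hΩo.measurableSet, isClosed_frontier.measurableSet]

theorem restrict_stratum (hΩo : IsOpen Ω)
    (σ : Measure (Fin d → ℝ)) [SigmaFinite σ] (hσ : σ (frontier Ω)ᶜ = 0) (B : Finset (Fin N)) :
    (Measure.pi fun _ : Fin N => volume.restrict Ω + σ).restrict (stratum Ω B) =
      Measure.pi fun i => if i ∈ B then volume.restrict Ω else σ := by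
  have hdisj : Disjoint (frontier Ω) Ω := by
    rw [hΩo.frontier_eq]
    exact Set.disjoint_sdiff_left
  rw [stratum, Measure.restrict_pi_pi]
  congr 1
  funext i
  split_ifs
  · rw [Measure.restrict_add, Measure.restrict_restrict hΩo.measurableSet, Set.inter_self,
      Measure.restrict_eq_zero.2 (measure_mono_null hdisj.subset_compl_left hσ), add_zero]
  · rw [Measure.restrict_add, Measure.restrict_restrict isClosed_frontier.measurableSet,
      hdisj.inter_eq, Measure.restrict_empty, zero_add]
    exact Measure.restrict_eq_self_of_ae_mem hσ

theorem forall_mem_closure_subset_iUnion_stratum (hΩo : IsOpen Ω) :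
    {x : Fin N → Fin d → ℝ | ∀ i, x i ∈ closure Ω} ⊆ ⋃ B : Finset (Fin N), stratum Ω B := by
  classical
  intro x hx
  refine Set.mem_iUnion.2 ⟨Finset.univ.filter fun i => x i ∈ Ω, fun i _ => ?_⟩
  by_cases hi : x i ∈ Ω
  · simp [hi]
  · simpa [hi, hΩo.frontier_eq] using hx i

theorem stratum_subset (B : Finset (Fin N)) :
    stratum Ω B ⊆ {x | ∀ i, x i ∈ closure Ω} := by
  intro x hx i
  have h := hx i (Set.mem_univ i)
  dsimp only at h
  split_ifs at h
  exacts [subset_closure h, frontier_subset_closure h]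

end Stratification

/-- `1_Ω(xⁱ) ∂_{i,k} f(x)`. -/
noncomputable def interiorDeriv {d N : ℕ} (Ω : Set (Fin d → ℝ)) (i : Fin N) (k : Fin d)
    (f : (Fin N → Fin d → ℝ) → ℝ) (x : Fin N → Fin d → ℝ) : ℝ :=
  Set.indicator Ω (fun _ => (1 : ℝ)) (x i) * fderiv ℝ f x (Pi.single i (Pi.single k 1))

section InteriorDeriv

variable {d N : ℕ} {Ω : Set (Fin d → ℝ)}

theorem measurable_interiorDeriv (hΩo : IsOpen Ω) (i : Fin N) (k : Fin d)
    {f : (Fin N → Fin d → ℝ) → ℝ} (hf : ContDiff ℝ 1 f) :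
    Measurable (interiorDeriv Ω i k f) :=
  ((measurable_const.indicator hΩo.measurableSet).comp (measurable_pi_apply i)).mul
    ((hf.continuous_fderiv one_ne_zero).clm_apply continuous_const).measurable

theorem memLp_of_isCompact_of_continuous {α : Type*} [TopologicalSpace α] [MeasurableSpace α]
    [OpensMeasurableSpace α] {μ : Measure α} [IsFiniteMeasure μ] {K : Set α} (hK : IsCompact K)
    (hμK : ∀ᵐ x ∂μ, x ∈ K) {g : α → ℝ} (hg : Continuous g) (p : ℝ≥0∞) : MemLp g p μ := by
  obtain ⟨C, hC⟩ := hK.exists_bound_of_continuousOn hg.continuousOn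
  exact MemLp.of_bound hg.measurable.aestronglyMeasurable C (hμK.mono fun x hx => hC x hx)

theorem memLp_interiorDeriv (hΩo : IsOpen Ω) {μ : Measure (Fin N → Fin d → ℝ)}
    [IsFiniteMeasure μ] {K : Set (Fin N → Fin d → ℝ)} (hK : IsCompact K)
    (hμK : ∀ᵐ x ∂μ, x ∈ K) (i : Fin N) (k : Fin d)
    {f : (Fin N → Fin d → ℝ) → ℝ} (hf : ContDiff ℝ 1 f) (p : ℝ≥0∞) :
    MemLp (interiorDeriv Ω i k f) p μ := by
  refine (memLp_of_isCompact_of_continuous hK hμK ((hf.continuous_fderiv one_ne_zero).clm_apply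
    (continuous_const (y := Pi.single i (Pi.single k 1)))) p).mono
    (measurable_interiorDeriv hΩo i k hf).aestronglyMeasurable (.of_forall fun x => ?_)
  rw [interiorDeriv, norm_mul]
  refine mul_le_of_le_one_left (norm_nonneg _) ?_
  by_cases hx : x i ∈ Ω <;> simp [hx]

theorem interiorDeriv_sub (i : Fin N) (k : Fin d) {f g : (Fin N → Fin d → ℝ) → ℝ}
    (hf : ContDiff ℝ 1 f) (hg : ContDiff ℝ 1 g) :
    interiorDeriv Ω i k (fun x => f x - g x) = interiorDeriv Ω i k f - interiorDeriv Ω i k g := by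
  ext x
  simp only [interiorDeriv, Pi.sub_apply]
  rw [fderiv_fun_sub (hf.differentiable one_ne_zero x) (hg.differentiable one_ne_zero x)]
  simp [mul_sub]

theorem stickyForm_self_eq_sum {Λ : Set (Fin N → Fin d → ℝ)} {μ : Measure (Fin N → Fin d → ℝ)}
    {g : (Fin N → Fin d → ℝ) → ℝ}
    (hg : ∀ i k, MemLp (interiorDeriv Ω i k g) 2 (μ.restrict Λ)) :
    stickyForm d N Ω Λ μ g g =
      (1 / 2) * ∑ i, ∑ k, ∫ x in Λ, (interiorDeriv Ω i k g x) ^ 2 ∂μ := by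
  rw [stickyForm]
  congr 1
  have h_int : ∀ i k, Integrable (fun x => (interiorDeriv Ω i k g x) ^ 2) (μ.restrict Λ) :=
    fun i k => (hg i k).integrable_sq
  simp_rw [← integral_finsetSum _ fun k _ => h_int _ k]
  rw [← integral_finsetSum _ fun i _ => integrable_finsetSum _ fun k _ => h_int i k]
  refine integral_congr_ae (.of_forall fun x => Finset.sum_congr rfl fun i _ => ?_)
  simp only [gradBlockInner, interiorDeriv, Finset.mul_sum]
  refine Finset.sum_congr rfl fun k _ => ?_
  by_cases hx : x i ∈ Ω <;> simp [hx, sq]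

theorem integral_interiorDeriv_sq_le {Λ : Set (Fin N → Fin d → ℝ)}
    {μ : Measure (Fin N → Fin d → ℝ)} {g : (Fin N → Fin d → ℝ) → ℝ}
    (hg : ∀ i k, MemLp (interiorDeriv Ω i k g) 2 (μ.restrict Λ)) (i : Fin N) (k : Fin d) :
    ∫ x in Λ, (interiorDeriv Ω i k g x) ^ 2 ∂μ ≤ 2 * stickyForm d N Ω Λ μ g g := by
  have hnn : ∀ i k, 0 ≤ ∫ x in Λ, (interiorDeriv Ω i k g x) ^ 2 ∂μ := fun i k =>
    integral_nonneg fun x => sq_nonneg _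
  rw [stickyForm_self_eq_sum hg, ← mul_assoc]
  norm_num
  exact (Finset.single_le_sum (f := fun k => ∫ x in Λ, (interiorDeriv Ω i k g x) ^ 2 ∂μ)
    (fun k _ => hnn i k) (Finset.mem_univ k)).trans
    (Finset.single_le_sum (f := fun i => ∑ k, ∫ x in Λ, (interiorDeriv Ω i k g x) ^ 2 ∂μ)
      (fun i _ => Finset.sum_nonneg fun k _ => hnn i k) (Finset.mem_univ i))

end InteriorDeriv

theorem norm_toLp_sq_eq_integral {α : Type*} [MeasurableSpace α] {μ : Measure α} {u : α → ℝ}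
    (hu : MemLp u 2 μ) : ‖hu.toLp u‖ ^ 2 = ∫ x, u x ^ 2 ∂μ := by
  rw [← real_inner_self_eq_norm_sq, L2.inner_def]
  refine integral_congr_ae ?_
  filter_upwards [hu.coeFn_toLp] with x hx
  simp [hx, sq]

theorem lintegral_enorm_sq_eq {α : Type*} [MeasurableSpace α] {μ : Measure α} (u : α → ℝ) :
    ∫⁻ x, ‖u x‖ₑ ^ 2 ∂μ = eLpNorm u 2 μ ^ 2 := by
  have h := eLpNorm_nnreal_pow_eq_lintegral (f := u) (μ := μ) (p := 2) two_ne_zero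
  simpa [ENNReal.rpow_two] using h.symm

/-- Under the Hamza condition, the only possible `L²(μ)`-limit of `1_Ω(xⁱ) ∂_{i,k} fₙ` along a
sequence `fₙ → 0` in `L²(μ)` is zero. -/
theorem interiorDeriv_limit_ae_eq_zero {d N : ℕ} {Ω : Set (Fin d → ℝ)} (hΩo : IsOpen Ω)
    (σ : Measure (Fin d → ℝ)) [SigmaFinite σ] (hσ : σ (frontier Ω)ᶜ = 0)
    {w : (Fin N → Fin d → ℝ) → ℝ≥0∞} (hw : Measurable w) (hwt : ∀ x, w x ≠ ⊤)
    (hH : ∀ B : Finset (Fin N), B.Nonempty →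
      ∀ᵐ x ∂(Measure.pi fun _ : {i : Fin N // i ∉ B} => σ),
      ∀ᵐ y ∂(Measure.pi fun _ : {i : Fin N // i ∈ B} => volume.restrict Ω),
        y ∉ {y' : {i : Fin N // i ∈ B} → Fin d → ℝ | ∃ ε > 0,
          (∫⁻ z in Metric.ball y' ε, (w (fillConfig d N B x z))⁻¹
            ∂(Measure.pi fun _ : {i : Fin N // i ∈ B} => volume.restrict Ω)) < ⊤} →
        w (fillConfig d N B x y) = 0)
    {μ : Measure (Fin N → Fin d → ℝ)}
    (hμ : μ = ((Measure.pi fun _ : Fin N => volume.restrict Ω + σ).restrict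
      {x | ∀ i, x i ∈ closure Ω}).withDensity w)
    {f : ℕ → (Fin N → Fin d → ℝ) → ℝ} (hf : ∀ n, ContDiff ℝ 1 (f n)) (i : Fin N) (k : Fin d)
    {h : (Fin N → Fin d → ℝ) → ℝ} (hh : Measurable h)
    (hf0 : Tendsto (fun n => ∫⁻ z, ‖f n z‖ₑ ^ 2 ∂μ) atTop (𝓝 0))
    (hfh : Tendsto (fun n => ∫⁻ z, ‖interiorDeriv Ω i k (f n) z - h z‖ₑ ^ 2 ∂μ) atTop (𝓝 0)) :
    ∀ᵐ z ∂μ, h z = 0 := by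
  have hstrat : ∀ (B : Finset (Fin N)) (F : ℕ → (Fin N → Fin d → ℝ) → ℝ≥0∞),
      (∀ n, Measurable (F n)) → Tendsto (fun n => ∫⁻ z, F n z ∂μ) atTop (𝓝 0) →
      Tendsto (fun n => ∫⁻ z in stratum Ω B, F n z * w z
        ∂(Measure.pi fun _ : Fin N => volume.restrict Ω + σ)) atTop (𝓝 0) := by
    intro B F hF hlim
    refine tendsto_of_tendsto_of_tendsto_of_le_of_le tendsto_const_nhds hlim
      (fun _ => zero_le) fun n => ?_
    dsimp only
    rw [hμ, lintegral_withDensity_eq_lintegral_mul _ hw (hF n)]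
    simp only [Pi.mul_apply, mul_comm (w _)]
    exact lintegral_mono_set (stratum_subset B)
  have hum : ∀ n, Measurable (interiorDeriv Ω i k (f n)) := fun n =>
    measurable_interiorDeriv hΩo i k (hf n)
  have hA := fun B => hstrat B _ (fun n => (hf n).continuous.measurable.enorm.pow_const 2) hf0
  have hD := fun B => hstrat B _ (fun n => ((hum n).sub hh).enorm.pow_const 2) hfh
  have hdisj : ∀ x ∈ frontier Ω, x ∉ Ω := fun x hx => by
    rw [hΩo.frontier_eq] at hx
    exact hx.2
  have hmain : ∀ B : Finset (Fin N), ∀ᵐ z ∂(Measure.pi fun _ : Fin N =>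
      volume.restrict Ω + σ).restrict (stratum Ω B), w z = 0 ∨ h z = 0 := by
    intro B
    by_cases hi : i ∈ B
    · have hD' := (hD B).congr fun n => setLIntegral_congr_fun
        (g := fun z => ‖fderiv ℝ (f n) z (Pi.single i (Pi.single k 1)) - h z‖ₑ ^ 2 * w z)
        (measurableSet_stratum hΩo B) fun z hz => by
          have hzi : z i ∈ Ω := by simpa [hi] using hz i (Set.mem_univ i)
          simp [interiorDeriv, hzi]
      have hA' := hA B
      rw [restrict_stratum hΩo σ hσ B] at hA' hD' ⊢
      exact ae_weight_eq_zero_or_eq_zero_on_stratum hΩo σ B hw hwt (hH B ⟨i, hi⟩) hf hi _ hh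
        hA' hD'
    · have hD' := (hD B).congr fun n => setLIntegral_congr_fun
        (g := fun z => ‖h z‖ₑ ^ 2 * w z)
        (measurableSet_stratum hΩo B) fun z hz => by
          have hzi : z i ∉ Ω := hdisj _ (by simpa [hi] using hz i (Set.mem_univ i))
          simp [interiorDeriv, hzi]
      have h0 := tendsto_nhds_unique tendsto_const_nhds hD'
      rw [lintegral_eq_zero_iff (f := fun z => ‖h z‖ₑ ^ 2 * w z)
        ((hh.enorm.pow_const 2).mul hw)] at h0
      filter_upwards [h0] with z hz
      simpa [or_comm] using hz
  rw [hμ, ae_withDensity_iff hw]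
  refine ae_restrict_of_ae_restrict_of_subset
    (forall_mem_closure_subset_iUnion_stratum hΩo) ?_
  rw [ae_restrict_iUnion_iff]
  intro B
  filter_upwards [hmain B] with z hz hwz
  exact hz.resolve_left hwz

/-- Lemma 3.7 of the paper, case `δ = 0`: closability of the
pre-Dirichlet form of the `N`-particle system with sticky boundary under the
generalized Hamza condition (H1). -/
theorem stickyForm_closable {d N : ℕ}
    (Ω : Set (Fin d → ℝ)) (hΩo : IsOpen Ω) (hΩne : Ω.Nonempty)
    (hΩbd : Bornology.IsBounded Ω)
    (hΓnull : volume (frontier Ω) = 0)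
    (σ : Measure (Fin d → ℝ)) [IsFiniteMeasure σ] (hσ : σ (frontier Ω)ᶜ = 0)
    (Λ : Set (Fin N → Fin d → ℝ)) (hΛ : Λ = {x | ∀ i, x i ∈ closure Ω})
    (m : Measure (Fin N → Fin d → ℝ))
    (hm : m = Measure.pi fun _ : Fin N => volume.restrict Ω + σ)
    (ϱ : (Fin N → Fin d → ℝ) → ℝ) (hϱmeas : Measurable ϱ) (hϱnn : ∀ x, 0 ≤ ϱ x)
    (hϱint : (∫⁻ x in Λ, ENNReal.ofReal (ϱ x) ∂m) < ⊤)
    (hϱpos : ∀ᵐ x ∂m.restrict Λ, 0 < ϱ x)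
    (μ : Measure (Fin N → Fin d → ℝ))
    (hμ : μ = (m.restrict Λ).withDensity fun x => ENNReal.ofReal (ϱ x))
    -- the generalized Hamza condition (H1):
    (hH1 : ∀ B : Finset (Fin N), B.Nonempty →
      ∀ᵐ x ∂(Measure.pi fun _ : {i : Fin N // i ∉ B} => σ),
        (∀ i : {i : Fin N // i ∉ B}, x i ∈ frontier Ω) →
        ∀ᵐ y ∂(Measure.pi fun _ : {i : Fin N // i ∈ B} => volume.restrict Ω),
          (∀ i : {i : Fin N // i ∈ B}, y i ∈ Ω) →
          y ∉ {y' : {i : Fin N // i ∈ B} → Fin d → ℝ | ∃ ε > 0,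
            (∫⁻ z in Metric.ball y' ε,
              (ENNReal.ofReal (ϱ (fillConfig d N B x z)))⁻¹
                ∂(Measure.pi fun _ : {i : Fin N // i ∈ B} => volume.restrict Ω)) < ⊤} →
          ϱ (fillConfig d N B x y) = 0)
    -- closability: an `E`-Cauchy sequence of `C¹` functions tending to `0` in `L²(μ)`
    -- has energy tending to `0`:
    (f : ℕ → (Fin N → Fin d → ℝ) → ℝ) (hf : ∀ k, ContDiff ℝ 1 (f k))
    (hCauchy : ∀ ε > 0, ∃ K : ℕ, ∀ k ≥ K, ∀ l ≥ K,
      stickyForm d N Ω Λ μ (fun x => f k x - f l x) (fun x => f k x - f l x) < ε)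
    (hL2 : Filter.Tendsto (fun k => ∫ x in Λ, (f k x) ^ 2 ∂μ)
      Filter.atTop (nhds 0)) :
    Filter.Tendsto (fun k => stickyForm d N Ω Λ μ (f k) (f k))
      Filter.atTop (nhds 0) := by
  subst hΛ hm
  have hw : Measurable fun x => ENNReal.ofReal (ϱ x) := hϱmeas.ennreal_ofReal
  set Λ : Set (Fin N → Fin d → ℝ) := {x | ∀ i, x i ∈ closure Ω} with hΛ
  have hK : IsCompact Λ := by
    have h : Λ = Set.univ.pi fun _ => closure Ω := by ext; simp [hΛ]
    rw [h]
    exact isCompact_univ_pi fun _ => hΩbd.isCompact_closure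
  have hΛm : MeasurableSet Λ := hK.measurableSet
  have hμΛ : μ.restrict Λ = μ := by
    rw [hμ, restrict_withDensity hΛm, Measure.restrict_restrict hΛm, Set.inter_self]
  have hfin : IsFiniteMeasure μ := hμ ▸ isFiniteMeasure_withDensity hϱint.ne
  have hμK : ∀ᵐ x ∂μ, x ∈ Λ := hμΛ ▸ ae_restrict_mem hΛm
  have hmemf : ∀ n, MemLp (f n) 2 μ := fun n =>
    memLp_of_isCompact_of_continuous hK hμK (hf n).continuous 2
  have hmem : ∀ i k (g : (Fin N → Fin d → ℝ) → ℝ), ContDiff ℝ 1 g →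
      MemLp (interiorDeriv Ω i k g) 2 μ := fun i k g hg =>
    memLp_interiorDeriv hΩo hK hμK i k hg 2
  have hf0 : Tendsto (fun n => ∫⁻ z, ‖f n z‖ₑ ^ 2 ∂μ) atTop (𝓝 0) := by
    rw [hμΛ] at hL2
    have h := ENNReal.tendsto_ofReal hL2
    rw [ENNReal.ofReal_zero] at h
    refine h.congr fun n => ?_
    rw [ofReal_integral_eq_lintegral_ofReal (hmemf n).integrable_sq
      (.of_forall fun x => sq_nonneg _)]
    refine lintegral_congr fun x => ?_
    rw [← sq_abs, ENNReal.ofReal_pow (abs_nonneg _), ← Real.enorm_eq_ofReal_abs]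
  have hH : ∀ B : Finset (Fin N), B.Nonempty →
      ∀ᵐ x ∂(Measure.pi fun _ : {i : Fin N // i ∉ B} => σ),
      ∀ᵐ y ∂(Measure.pi fun _ : {i : Fin N // i ∈ B} => volume.restrict Ω),
        y ∉ {y' : {i : Fin N // i ∈ B} → Fin d → ℝ | ∃ ε > 0,
          (∫⁻ z in Metric.ball y' ε, (ENNReal.ofReal (ϱ (fillConfig d N B x z)))⁻¹
            ∂(Measure.pi fun _ : {i : Fin N // i ∈ B} => volume.restrict Ω)) < ⊤} →
        ENNReal.ofReal (ϱ (fillConfig d N B x y)) = 0 := by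
    intro B hB
    filter_upwards [hH1 B hB, ae_pi_forall_mem hσ] with x hx hxΓ
    filter_upwards [hx hxΓ, ae_pi_forall_mem (σ := volume.restrict Ω) (s := Ω)
      (ae_restrict_mem hΩo.measurableSet)] with y hy hyΩ hyR
    rw [hy hyΩ hyR, ENNReal.ofReal_zero]
  have hlim : ∀ i k, Tendsto (fun n => ∫ x in Λ, (interiorDeriv Ω i k (f n) x) ^ 2 ∂μ)
      atTop (𝓝 0) := by
    intro i k
    rw [hμΛ]
    set u : ℕ → Lp ℝ 2 μ := fun n => (hmem i k (f n) (hf n)).toLp _ with hu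
    have hcauchy : CauchySeq u := by
      refine Metric.cauchySeq_iff.2 fun ε hε => ?_
      obtain ⟨K, hK⟩ := hCauchy (ε ^ 2 / 2) (by positivity)
      refine ⟨K, fun a ha b hb => ?_⟩
      have hle := integral_interiorDeriv_sq_le (Ω := Ω) (Λ := Λ) (μ := μ)
        (g := fun x => f a x - f b x)
        (fun i k => by rw [hμΛ]; exact hmem i k _ ((hf a).sub (hf b))) i k
      rw [hμΛ] at hle
      have hsq : ‖u a - u b‖ ^ 2 =
          ∫ x, (interiorDeriv Ω i k (fun x => f a x - f b x) x) ^ 2 ∂μ := by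
        rw [hu, interiorDeriv_sub i k (hf a) (hf b), ← MemLp.toLp_sub, norm_toLp_sq_eq_integral]
      rw [dist_eq_norm]
      refine lt_of_pow_lt_pow_left₀ 2 hε.le ?_
      linarith [hK a ha b hb]
    obtain ⟨H, hH'⟩ := cauchySeq_tendsto_of_complete hcauchy
    obtain ⟨h, hhm, hHh⟩ : ∃ h : (Fin N → Fin d → ℝ) → ℝ, Measurable h ∧ H =ᵐ[μ] h :=
      ⟨_, (Lp.aestronglyMeasurable H).measurable_mk, (Lp.aestronglyMeasurable H).ae_eq_mk⟩
    have hzero : ∀ᵐ z ∂μ, h z = 0 := by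
      refine interiorDeriv_limit_ae_eq_zero hΩo σ hσ hw
        (fun _ => ENNReal.ofReal_ne_top) hH hμ hf i k hhm hf0 ?_
      have hp := (Lp.tendsto_Lp_iff_tendsto_eLpNorm' u H).1 hH'
      have hp2 := ENNReal.Tendsto.pow (n := 2) hp
      rw [zero_pow two_ne_zero] at hp2
      refine hp2.congr fun n => ?_
      rw [← lintegral_enorm_sq_eq]
      refine lintegral_congr_ae ?_
      filter_upwards [(hmem i k (f n) (hf n)).coeFn_toLp, hHh] with x hx hx'
      simp only [Pi.sub_apply, hu, hx, hx']
    have hH0 : H = 0 := by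
      rw [Lp.eq_zero_iff_ae_eq_zero]
      filter_upwards [hHh, hzero] with x hx hx'
      rw [hx, hx']; rfl
    have hn := (hH'.norm).pow 2
    rw [hH0, norm_zero, zero_pow two_ne_zero] at hn
    exact hn.congr fun n => norm_toLp_sq_eq_integral _
  have hsum := (tendsto_finsetSum Finset.univ fun i _ =>
    tendsto_finsetSum Finset.univ fun k _ => hlim i k).const_mul (1 / 2 : ℝ)
  simp only [Finset.sum_const_zero, mul_zero] at hsum
  refine hsum.congr fun n => (stickyForm_self_eq_sum fun i k => ?_).symm
  rw [hμΛ]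
  exact hmem i k _ (hf n)
end

section
/- Let Ω ⊆ ℝ^d be a nonempty bounded open set with boundary Γ := ∂Ω, let N ∈ ℕ, and let Λ := (closure Ω)^N ⊆ (ℝ^d)^N. Let f, g : (ℝ^d)^N → ℝ be differentiable, and suppose g is constant on U, where U is an open neighborhood in the subspace topology of Λ of the support of f restricted to Λ (i.e. U = V ∩ Λ for some open V ⊆ (ℝ^d)^N, and the closure of {x ∈ Λ : f(x) ≠ 0} in Λ is contained in U). Then for every x ∈ Λ and every i ∈ {1,…,N} with x^i ∈ Ω one has ⟨∇_i f(x), ∇_i g(x)⟩ = 0; consequently, for every Borel measure μ on Λ, E(f,g) := ½ ∫_Λ Σ_{i=1}^N 1_Ω(x^i) ⟨∇_i f(x), ∇_i g(x)⟩ dμ(x) = 0. -/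
open MeasureTheory

/-- If a differentiable function is locally constant along the line through `x` in direction `v`,
then its derivative at `x` in direction `v` vanishes. -/
theorem fderiv_apply_eq_zero_of_eventually_eq_along {E : Type*} [NormedAddCommGroup E]
    [NormedSpace ℝ E] {f : E → ℝ} {x v : E} (hf : DifferentiableAt ℝ f x)
    (h : ∀ᶠ t : ℝ in nhds 0, f (x + t • v) = f x) : fderiv ℝ f x v = 0 := by
  rw [← hf.lineDeriv_eq_fderiv, lineDeriv]
  exact (Filter.EventuallyEq.deriv_eq (f := fun _ => f x) h).trans (deriv_const _ _)

/-- Moving only the `i`-th component, and only slightly, keeps a point of a product set inside it,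
provided that this component starts in an open subset of the factor. -/
theorem eventually_add_smul_single_mem {ι F : Type*} [DecidableEq ι] [NormedAddCommGroup F]
    [NormedSpace ℝ F] {s t : Set F} (hs : IsOpen s) (hst : s ⊆ t) {x : ι → F}
    (hx : ∀ j, x j ∈ t) {i : ι} (hi : x i ∈ s) (w : F) :
    ∀ᶠ r : ℝ in nhds 0, ∀ j, (x + r • (Pi.single i w : ι → F)) j ∈ t := by
  have hc : Continuous fun r : ℝ => x i + r • w := by fun_prop
  have h : ∀ᶠ r : ℝ in nhds 0, x i + r • w ∈ s :=
    hc.continuousAt.eventually_mem (hs.mem_nhds (by simpa using hi))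
  filter_upwards [h] with r hr j
  rcases eq_or_ne j i with rfl | hj
  · simpa using hst hr
  · simpa [hj] using hx j

/-- strong locality, from the proof of Proposition 3.9, case `δ = 0`.
If `g` is constant on an open neighborhood `U` (in the subspace topology of
`Λ = (closure Ω)^N`) of the support of `f` restricted to `Λ`, then for every `x ∈ Λ`
and every `i` with `xⁱ ∈ Ω` the block inner product `⟨∇_i f(x), ∇_i g(x)⟩` vanishes;
consequently `E(f,g) = 0` for every Borel measure `μ` on `Λ`. -/
theorem stickyForm_strongly_local {d N : ℕ}
    (Ω : Set (Fin d → ℝ)) (hΩo : IsOpen Ω) (hΩne : Ω.Nonempty)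
    (hΩbd : Bornology.IsBounded Ω)
    (Λ : Set (Fin N → Fin d → ℝ)) (hΛ : Λ = {x | ∀ i, x i ∈ closure Ω})
    (f g : (Fin N → Fin d → ℝ) → ℝ)
    (hf : Differentiable ℝ f) (hg : Differentiable ℝ g)
    (V : Set (Fin N → Fin d → ℝ)) (hV : IsOpen V)
    (U : Set (Fin N → Fin d → ℝ)) (hU : U = V ∩ Λ)
    (hsupp : closure {x | x ∈ Λ ∧ f x ≠ 0} ∩ Λ ⊆ U)
    (hgconst : ∀ x ∈ U, ∀ y ∈ U, g x = g y) :
    (∀ x ∈ Λ, ∀ i : Fin N, x i ∈ Ω →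
      (∑ k : Fin d, fderiv ℝ f x (Pi.single i (Pi.single k 1)) *
        fderiv ℝ g x (Pi.single i (Pi.single k 1))) = 0) ∧
    (∀ μ : Measure (Fin N → Fin d → ℝ),
      (1 / 2) * ∫ x in Λ,
        ∑ i, Set.indicator Ω (fun _ => (1 : ℝ)) (x i) *
          ∑ k : Fin d, fderiv ℝ f x (Pi.single i (Pi.single k 1)) *
            fderiv ℝ g x (Pi.single i (Pi.single k 1)) ∂μ = 0) := by
  have key : ∀ x ∈ Λ, ∀ i : Fin N, x i ∈ Ω →
      (∑ k : Fin d, fderiv ℝ f x (Pi.single i (Pi.single k 1)) *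
        fderiv ℝ g x (Pi.single i (Pi.single k 1))) = 0 := by
    intro x hx i hi
    refine Finset.sum_eq_zero fun k _ => ?_
    set v : Fin N → Fin d → ℝ := Pi.single i (Pi.single k 1)
    have hmem : ∀ᶠ t : ℝ in nhds 0, x + t • v ∈ Λ := by
      rw [hΛ] at hx ⊢
      exact eventually_add_smul_single_mem hΩo subset_closure hx hi _
    have hc : ContinuousAt (fun t : ℝ => x + t • v) 0 := by fun_prop
    have hline {W : Set (Fin N → Fin d → ℝ)} (hW : IsOpen W) (hxW : x ∈ W) :
        ∀ᶠ t : ℝ in nhds 0, x + t • v ∈ W :=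
      hc.eventually_mem (hW.mem_nhds (by simpa using hxW))
    by_cases hxs : x ∈ closure {x | x ∈ Λ ∧ f x ≠ 0}
    · have hxU : x ∈ U := hsupp ⟨hxs, hx⟩
      refine mul_eq_zero_of_right _ (fderiv_apply_eq_zero_of_eventually_eq_along (hg x) ?_)
      filter_upwards [hmem, hline hV (hU ▸ hxU).1] with t ht htV
      exact hgconst _ (hU ▸ ⟨htV, ht⟩) _ hxU
    · have hzero : ∀ y ∈ Λ, y ∉ closure {x | x ∈ Λ ∧ f x ≠ 0} → f y = 0 := by
        intro y hy hys
        by_contra hfy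
        exact hys (subset_closure ⟨hy, hfy⟩)
      refine mul_eq_zero_of_left (fderiv_apply_eq_zero_of_eventually_eq_along (hf x) ?_) _
      filter_upwards [hmem, hline isClosed_closure.isOpen_compl hxs] with t ht hts
      rw [hzero _ ht hts, hzero x hx hxs]
  refine ⟨key, fun μ => ?_⟩
  rw [setIntegral_eq_zero_of_forall_eq_zero, mul_zero]
  intro x hx
  refine Finset.sum_eq_zero fun i _ => ?_
  by_cases hi : x i ∈ Ω
  · rw [key x hx i hi, mul_zero]
  · rw [Set.indicator_of_notMem hi, zero_mul]
end
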